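/- Let K be a finite field of characteristic different from 2, K̄ an algebraic closure of K, n ≥ 2 an even integer, and G a subgroup of GSp_n(K̄) such that the subgroup of G generated by the transvections contained in G equals Sp_n(K). Let π: GSp_n(K̄) → GSp_n(K̄)/(K̄^×·Id_n) be the quotient by the scalar matrices. Then π(G) equals either π(Sp_n(K)) (i.e. PSp_n(K)) or π(GSp_n(K)) (i.e. PGSp_n(K)). -/

import Mathlib

open Matrix

noncomputable section

/-- The Gram matrix of the standard symplectic form on `R^n` (for `n` even):
block form `[[0, I], [-I, 0]]`. -/
def stdJ (n : ℕ) (R : Type*) [CommRing R] : Matrix (Fin n) (Fin n) R :=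
  Matrix.of fun i j =>
    if i.val + n / 2 = j.val then 1 else if j.val + n / 2 = i.val then -1 else 0

/-- A transvection: a matrix `T ≠ 1` such that `T - 1` has rank `1`. -/
def IsTransvection {n : ℕ} {R : Type*} [CommRing R]
    (A : Matrix (Fin n) (Fin n) R) : Prop :=
  A ≠ 1 ∧ (A - 1).rank = 1

/-- `Sp_n(K)` viewed inside `GL_n(K̄)`. -/
def SpOver (K : Type*) [Field K] (n : ℕ) :
    Set (Matrix (Fin n) (Fin n) (AlgebraicClosure K))ˣ :=
  {A | (∀ i j, ∃ b : K, algebraMap K (AlgebraicClosure K) b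
          = (A : Matrix (Fin n) (Fin n) (AlgebraicClosure K)) i j) ∧
    (A : Matrix (Fin n) (Fin n) (AlgebraicClosure K))ᵀ * stdJ n (AlgebraicClosure K)
      * (A : Matrix (Fin n) (Fin n) (AlgebraicClosure K))
      = stdJ n (AlgebraicClosure K)}

/-- `GSp_n(K)` viewed inside `GL_n(K̄)`. -/
def GSpOver (K : Type*) [Field K] (n : ℕ) :
    Set (Matrix (Fin n) (Fin n) (AlgebraicClosure K))ˣ :=
  {A | (∀ i j, ∃ b : K, algebraMap K (AlgebraicClosure K) b
          = (A : Matrix (Fin n) (Fin n) (AlgebraicClosure K)) i j) ∧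
    ∃ α : (AlgebraicClosure K)ˣ,
      (A : Matrix (Fin n) (Fin n) (AlgebraicClosure K))ᵀ * stdJ n (AlgebraicClosure K)
        * (A : Matrix (Fin n) (Fin n) (AlgebraicClosure K))
        = (α : AlgebraicClosure K) • stdJ n (AlgebraicClosure K)}

/-- `A` and `B` have the same image under the projection modulo scalar matrices. -/
def ScalarRel {K : Type*} [Field K] {n : ℕ}
    (A B : (Matrix (Fin n) (Fin n) (AlgebraicClosure K))ˣ) : Prop :=
  ∃ lam : (AlgebraicClosure K)ˣ,
    (A : Matrix (Fin n) (Fin n) (AlgebraicClosure K))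
      = (lam : AlgebraicClosure K) • (B : Matrix (Fin n) (Fin n) (AlgebraicClosure K))

section SymplecticForm

variable {n : ℕ} {R : Type*} [CommRing R]

theorem stdJ_transpose (hn : 2 ≤ n) : (stdJ n R)ᵀ = -stdJ n R := by
  ext i j
  simp only [stdJ, transpose_apply, of_apply, Matrix.neg_apply]
  split_ifs <;> first | omega | simp

theorem stdJ_mul_self (hn : Even n) : stdJ n R * stdJ n R = -1 := by
  obtain ⟨m, rfl⟩ := hn
  have hm : (m + m) / 2 = m := by omega
  ext i j
  rw [mul_apply]
  simp only [stdJ, of_apply, Matrix.neg_apply, one_apply, hm]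
  rcases lt_or_ge i.val m with hi | hi
  · rw [Finset.sum_eq_single (⟨i.val + m, by omega⟩ : Fin (m + m))]
    · simp only [Fin.ext_iff, ↓reduceIte, one_mul]
      split_ifs <;> first | omega | simp
    · intro k _ hk
      rw [Ne, Fin.ext_iff] at hk
      simp only at hk
      rw [if_neg (by omega), if_neg (by omega), zero_mul]
    · simp
  · rw [Finset.sum_eq_single (⟨i.val - m, by omega⟩ : Fin (m + m))]
    · simp only [Fin.ext_iff]
      split_ifs <;> first | omega | simp
    · intro k _ hk
      rw [Ne, Fin.ext_iff] at hk
      simp only at hk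
      rw [if_neg (by omega), if_neg (by omega), zero_mul]
    · simp

theorem stdJ_mem_subring (F : Subring R) (i j : Fin n) : stdJ n R i j ∈ F := by
  simp only [stdJ, of_apply]
  split_ifs
  · exact F.one_mem
  · exact F.neg_mem F.one_mem
  · exact F.zero_mem

theorem exists_stdJ_apply_eq_one (hn : 2 ≤ n) : ∃ i j, stdJ n R i j = 1 :=
  ⟨⟨0, by omega⟩, ⟨n / 2, by omega⟩, by simp [stdJ]⟩

end SymplecticForm

theorem mul_apply_mem {ι R : Type*} [Fintype ι] [CommRing R] {F : Subring R}
    {A B : Matrix ι ι R} (hA : ∀ i j, A i j ∈ F) (hB : ∀ i j, B i j ∈ F) (i j : ι) :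
    (A * B) i j ∈ F := by
  rw [mul_apply]
  exact F.sum_mem fun k _ => F.mul_mem (hA i k) (hB k j)

/-- If the rank-one forms `α⁻¹ • (g v) (g v)ᵀ` are defined over a subfield `F` for all `F`-rational
`v`, then `g` is proportional to a matrix over `F`. -/
theorem inv_mul_apply_mem {ι L : Type*} [Fintype ι] [DecidableEq ι] [Field L] {F : Subfield L}
    (h2 : (2 : L) ≠ 0) {g : Matrix ι ι L} {α : L} (hα : α ≠ 0)
    (H : ∀ v : ι → L, (∀ i, v i ∈ F) → ∀ a b, α⁻¹ * ((g *ᵥ v) a * (g *ᵥ v) b) ∈ F)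
    {i j : ι} (hij : g i j ≠ 0) (k l : ι) : (g i j)⁻¹ * g k l ∈ F := by
  have hsingle (c : ι) (i : ι) : (Pi.single c 1 : ι → L) i ∈ F := by
    rw [Pi.single_apply]
    split_ifs
    · exact F.one_mem
    · exact F.zero_mem
  have hdiag (c a b : ι) : α⁻¹ * (g a c * g b c) ∈ F := by
    simpa using H (Pi.single c 1) (hsingle c) a b
  have hpol (c d a b : ι) : α⁻¹ * (g a c * g b d + g a d * g b c) ∈ F := by
    have h := H (Pi.single c 1 + Pi.single d 1)
      (fun i => F.add_mem (hsingle c i) (hsingle d i)) a b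
    simp only [mulVec_add, Pi.add_apply, mulVec_single_one, col_apply] at h
    convert F.sub_mem (F.sub_mem h (hdiag c a b)) (hdiag d a b) using 1
    ring
  have h2F : (2 : L) ∈ F := ofNat_mem F 2
  have hrow : α⁻¹ * (g i j * g i l) ∈ F := by
    convert F.mul_mem (F.inv_mem h2F) (hpol j l i i) using 1
    field_simp
    ring
  have hprod : α⁻¹ * (g k j * g i l) ∈ F := by
    convert F.mul_mem (F.mul_mem (hdiag j k i) hrow) (F.inv_mem (hdiag j i i)) using 1
    field_simp
  have hmain : α⁻¹ * (g i j * g k l) ∈ F := by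
    convert F.sub_mem (hpol j l k i) hprod using 1
    ring
  convert F.mul_mem hmain (F.inv_mem (hdiag j i i)) using 1
  field_simp

theorem IsTransvection.conj {n : ℕ} {L : Type*} [Field L] {A : Matrix (Fin n) (Fin n) L}
    (hA : IsTransvection A) (g : (Matrix (Fin n) (Fin n) L)ˣ) :
    IsTransvection (g * A * (g⁻¹ : (Matrix (Fin n) (Fin n) L)ˣ) : Matrix (Fin n) (Fin n) L) := by
  have hsub : (g * A * (g⁻¹ : (Matrix (Fin n) (Fin n) L)ˣ) : Matrix (Fin n) (Fin n) L) - 1 =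
      g * (A - 1) * (g⁻¹ : (Matrix (Fin n) (Fin n) L)ˣ) := by
    rw [mul_sub, sub_mul, mul_one, Units.mul_inv]
  refine ⟨fun h => hA.1 ?_, ?_⟩
  · rw [Units.mul_inv_eq_iff_eq_mul, one_mul] at h
    exact g.isUnit.mul_left_cancel (h.trans (mul_one _).symm)
  · rw [hsub, rank_mul_eq_left_of_isUnit_det _ _ ((isUnit_iff_isUnit_det _).1 (Units.isUnit _)),
      rank_mul_eq_right_of_isUnit_det _ _ ((isUnit_iff_isUnit_det _).1 (Units.isUnit _)), hA.2]

theorem conj_mem_closure_transvections {n : ℕ} {L : Type*} [Field L]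
    {G : Subgroup (Matrix (Fin n) (Fin n) L)ˣ} {g t : (Matrix (Fin n) (Fin n) L)ˣ} (hg : g ∈ G)
    (ht : t ∈ Subgroup.closure {A | A ∈ G ∧ IsTransvection (A : Matrix (Fin n) (Fin n) L)}) :
    g * t * g⁻¹ ∈
      Subgroup.closure {A | A ∈ G ∧ IsTransvection (A : Matrix (Fin n) (Fin n) L)} := by
  induction ht using Subgroup.closure_induction with
  | mem x hx =>
    exact Subgroup.subset_closure
      ⟨G.mul_mem (G.mul_mem hg hx.1) (G.inv_mem hg), by simpa using hx.2.conj g⟩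
  | one => simp
  | mul x y _ _ hx hy => simpa [mul_assoc] using mul_mem hx hy
  | inv x _ hx => simpa [mul_assoc] using inv_mem hx

theorem isSquare_mul_of_not_isSquare {K : Type*} [Field K] [Finite K]
    {a b : K} (ha : ¬IsSquare a) (hb : ¬IsSquare b) : IsSquare (a * b) := by
  classical
  have := Fintype.ofFinite K
  have ha0 : a ≠ 0 := by rintro rfl; exact ha IsSquare.zero
  have hb0 : b ≠ 0 := by rintro rfl; exact hb IsSquare.zero
  rw [← quadraticChar_one_iff_isSquare (mul_ne_zero ha0 hb0), map_mul,
    quadraticChar_neg_one_iff_not_isSquare.2 ha, quadraticChar_neg_one_iff_not_isSquare.2 hb]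
  rfl

theorem vecMulVec_mul_stdJ_mul_self {n : ℕ} {L : Type*} [Field L] (hn : 2 ≤ n)
    (h2 : (2 : L) ≠ 0) (v : Fin n → L) :
    vecMulVec v v * stdJ n L * (vecMulVec v v * stdJ n L) = 0 := by
  have h : v ᵥ* stdJ n L ⬝ᵥ v = -(v ᵥ* stdJ n L ⬝ᵥ v) := by
    conv_lhs => rw [← neg_neg (stdJ n L), ← stdJ_transpose hn, vecMul_neg, vecMul_transpose,
      neg_dotProduct, dotProduct_comm, dotProduct_mulVec]
  have h0 : v ᵥ* stdJ n L ⬝ᵥ v = 0 := by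
    have : (2 : L) * (v ᵥ* stdJ n L ⬝ᵥ v) = 0 := by linear_combination h
    exact (mul_eq_zero.1 this).resolve_left h2
  rw [← mul_assoc, vecMulVec_mul, vecMulVec_mul_vecMulVec, h0]
  simp

/-- The symplectic transvection `x ↦ x + ⟨v, x⟩ v`. -/
def symplecticTransvection {n : ℕ} {L : Type*} [Field L] (hn : 2 ≤ n) (h2 : (2 : L) ≠ 0)
    (v : Fin n → L) : (Matrix (Fin n) (Fin n) L)ˣ where
  val := 1 + vecMulVec v v * stdJ n L
  inv := 1 - vecMulVec v v * stdJ n L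
  val_inv := by simp [mul_sub, add_mul, vecMulVec_mul_stdJ_mul_self hn h2 v]
  inv_val := by simp [mul_add, sub_mul, vecMulVec_mul_stdJ_mul_self hn h2 v]

theorem symplecticTransvection_isometry {n : ℕ} {L : Type*} [Field L] (hn : 2 ≤ n)
    (h2 : (2 : L) ≠ 0) (v : Fin n → L) :
    (symplecticTransvection hn h2 v : Matrix (Fin n) (Fin n) L)ᵀ * stdJ n L *
      (symplecticTransvection hn h2 v : Matrix (Fin n) (Fin n) L) = stdJ n L := by
  have h := vecMulVec_mul_stdJ_mul_self hn h2 v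
  have ht : (vecMulVec v v * stdJ n L)ᵀ = -(stdJ n L * vecMulVec v v) := by
    rw [transpose_mul, transpose_vecMulVec, stdJ_transpose hn, neg_mul]
  rw [mul_assoc] at h
  simp [symplecticTransvection, ht, mul_add, add_mul, mul_assoc, h]

theorem exists_forall_mul_apply_mem {n : ℕ} {L : Type*} [Field L] {F : Subfield L} (hn : 2 ≤ n)
    (hneven : Even n) (h2 : (2 : L) ≠ 0) {g : (Matrix (Fin n) (Fin n) L)ˣ} {α : Lˣ}
    (hg : (g : Matrix (Fin n) (Fin n) L)ᵀ * stdJ n L * (g : Matrix (Fin n) (Fin n) L) =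
      (α : L) • stdJ n L)
    (hconj : ∀ t : (Matrix (Fin n) (Fin n) L)ˣ,
      (∀ i j, (t : Matrix (Fin n) (Fin n) L) i j ∈ F) →
      (t : Matrix (Fin n) (Fin n) L)ᵀ * stdJ n L * (t : Matrix (Fin n) (Fin n) L) = stdJ n L →
      ∀ i j, (↑(g * t * g⁻¹) : Matrix (Fin n) (Fin n) L) i j ∈ F) :
    ∃ c : Lˣ, ∀ i j, (c : L) * (g : Matrix (Fin n) (Fin n) L) i j ∈ F := by
  have hJ := stdJ_mem_subring (n := n) F.toSubring
  have hinv : stdJ n L * (↑g⁻¹ : Matrix (Fin n) (Fin n) L) =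
      (α : L)⁻¹ • ((g : Matrix (Fin n) (Fin n) L)ᵀ * stdJ n L) := by
    rw [eq_inv_smul_iff₀ α.ne_zero, ← smul_mul, ← hg, Units.mul_inv_cancel_right]
  have H (v : Fin n → L) (hv : ∀ i, v i ∈ F) (a b : Fin n) :
      (α : L)⁻¹ * ((g.val *ᵥ v) a * (g.val *ᵥ v) b) ∈ F := by
    have hT : ∀ i j, (symplecticTransvection hn h2 v).val i j ∈ F := fun i j =>
      F.add_mem (by rw [one_apply]; split_ifs; exacts [F.one_mem, F.zero_mem])
        (mul_apply_mem (F := F.toSubring) (fun i j => F.mul_mem (hv i) (hv j)) hJ i j)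
    have hc := hconj _ hT (symplecticTransvection_isometry hn h2 v)
    set Q := (α : L)⁻¹ • vecMulVec (g.val *ᵥ v) (g.val *ᵥ v) with hQ
    have hval : (↑(g * symplecticTransvection hn h2 v * g⁻¹) : Matrix (Fin n) (Fin n) L) =
        1 + Q * stdJ n L := by
      have : Q = (α : L)⁻¹ • (g.val * vecMulVec v v * g.valᵀ) := by
        rw [hQ, mul_vecMulVec, vecMulVec_mul, vecMul_transpose]
      rw [this, Units.val_mul, Units.val_mul, symplecticTransvection, mul_add, add_mul, mul_one,
        Units.mul_inv, ← mul_assoc, mul_assoc _ (stdJ n L), hinv, Matrix.mul_smul, Matrix.smul_mul,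
        mul_assoc _ _ (stdJ n L)]
    have hQJ : ∀ i j, (Q * stdJ n L) i j ∈ F.toSubring := fun i j => by
      have := F.sub_mem (hc i j) (show (1 : Matrix (Fin n) (Fin n) L) i j ∈ F by
        rw [one_apply]; split_ifs; exacts [F.one_mem, F.zero_mem])
      rw [hval, Matrix.add_apply, add_sub_cancel_left] at this
      exact this
    have := F.neg_mem (mul_apply_mem hQJ hJ a b)
    rwa [mul_assoc, stdJ_mul_self hneven, mul_neg, mul_one, Matrix.neg_apply, neg_neg] at this
  obtain ⟨i, j, hij⟩ : ∃ i j, g.val i j ≠ 0 := by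
    by_contra! h
    have : Nonempty (Fin n) := ⟨⟨0, by omega⟩⟩
    exact g.ne_zero (Matrix.ext h)
  exact ⟨(Units.mk0 _ hij)⁻¹, fun k l => by
    simpa using inv_mul_apply_mem h2 α.ne_zero H hij k l⟩

theorem smul_mem_SpOver_of_multiplier_sq {K : Type*} [Field K] {n : ℕ}
    {h : (Matrix (Fin n) (Fin n) (AlgebraicClosure K))ˣ}
    (hF : ∀ i j, ∃ b : K, algebraMap K (AlgebraicClosure K) b = h.val i j)
    {d : (AlgebraicClosure K)ˣ} (hd : d.val ∈ (algebraMap K (AlgebraicClosure K)).fieldRange)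
    (hm : h.valᵀ * stdJ n (AlgebraicClosure K) * h.val =
      (d.val * d.val) • stdJ n (AlgebraicClosure K)) :
    d⁻¹ • h ∈ SpOver K n := by
  refine ⟨fun i j => ?_, ?_⟩
  · have := Subfield.mul_mem _ (Subfield.inv_mem _ hd) (hF i j)
    simpa [Units.smul_def] using this
  · simp [Units.smul_def, hm, smul_smul]

theorem exists_algebraMap_eq_multiplier {K : Type*} [Field K] {n : ℕ} (hn : 2 ≤ n)
    {h : (Matrix (Fin n) (Fin n) (AlgebraicClosure K))ˣ} (hh : h ∈ GSpOver K n) :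
    ∃ a : K, a ≠ 0 ∧ h.valᵀ * stdJ n (AlgebraicClosure K) * h.val =
      algebraMap K (AlgebraicClosure K) a • stdJ n (AlgebraicClosure K) := by
  obtain ⟨hF, α, hα⟩ := hh
  obtain ⟨i, j, hij⟩ := exists_stdJ_apply_eq_one (R := AlgebraicClosure K) hn
  have hmem : α.val ∈ (algebraMap K (AlgebraicClosure K)).fieldRange := by
    have h1 : (h.valᵀ * stdJ n (AlgebraicClosure K) * h.val) i j ∈
        (algebraMap K (AlgebraicClosure K)).fieldRange.toSubring :=
      mul_apply_mem (mul_apply_mem (fun i j => hF j i) (stdJ_mem_subring _)) hF i j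
    rw [hα, Matrix.smul_apply, hij, smul_eq_mul, mul_one] at h1
    exact h1
  obtain ⟨a, ha⟩ := hmem
  refine ⟨a, ?_, by rw [ha, hα]⟩
  rintro rfl
  exact α.ne_zero (by rw [← ha, map_zero])

theorem exists_smul_mem_SpOver {K : Type*} [Field K] {n : ℕ}
    {h : (Matrix (Fin n) (Fin n) (AlgebraicClosure K))ˣ}
    (hF : ∀ i j, ∃ b : K, algebraMap K (AlgebraicClosure K) b = h.val i j)
    {a : K} (ha0 : a ≠ 0) (ha : IsSquare a)
    (hm : h.valᵀ * stdJ n (AlgebraicClosure K) * h.val =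
      algebraMap K (AlgebraicClosure K) a • stdJ n (AlgebraicClosure K)) :
    ∃ d : (AlgebraicClosure K)ˣ, d • h ∈ SpOver K n := by
  obtain ⟨d, rfl⟩ := ha
  have hd : algebraMap K (AlgebraicClosure K) d ≠ 0 := by
    simpa using left_ne_zero_of_mul ha0
  exact ⟨(Units.mk0 _ hd)⁻¹,
    smul_mem_SpOver_of_multiplier_sq hF ⟨d, rfl⟩ (by rw [hm, map_mul, Units.val_mk0])⟩

theorem scalarRel_iff {K : Type*} [Field K] {n : ℕ}
    {A B : (Matrix (Fin n) (Fin n) (AlgebraicClosure K))ˣ} :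
    ScalarRel A B ↔ ∃ c : (AlgebraicClosure K)ˣ, A = c • B := by
  simp [ScalarRel, Units.ext_iff, Units.smul_def]

/-- If the subgroup of `G ⊆ GSp_n(K̄)` generated by the transvections in `G` equals
`Sp_n(K)` (with `K` finite of characteristic ≠ 2), then the image of `G` modulo
scalars equals `PSp_n(K)` or `PGSp_n(K)`. -/
theorem projective_image_PSp_or_PGSp
    {K : Type*} [Field K] [Fintype K] (hchar : ringChar K ≠ 2)
    {n : ℕ} (hn2 : 2 ≤ n) (hneven : Even n)
    (G : Subgroup (Matrix (Fin n) (Fin n) (AlgebraicClosure K))ˣ)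
    (hGSp : ∀ A ∈ G, ∃ α : (AlgebraicClosure K)ˣ,
      (A : Matrix (Fin n) (Fin n) (AlgebraicClosure K))ᵀ * stdJ n (AlgebraicClosure K)
        * (A : Matrix (Fin n) (Fin n) (AlgebraicClosure K))
        = (α : AlgebraicClosure K) • stdJ n (AlgebraicClosure K))
    (hgen : (Subgroup.closure {A | A ∈ G ∧
        IsTransvection (A : Matrix (Fin n) (Fin n) (AlgebraicClosure K))} :
        Set (Matrix (Fin n) (Fin n) (AlgebraicClosure K))ˣ) = SpOver K n) :
    (∀ X : (Matrix (Fin n) (Fin n) (AlgebraicClosure K))ˣ,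
        (∃ g ∈ G, ScalarRel X g) ↔ (∃ s ∈ SpOver K n, ScalarRel X s)) ∨
    (∀ X : (Matrix (Fin n) (Fin n) (AlgebraicClosure K))ˣ,
        (∃ g ∈ G, ScalarRel X g) ↔ (∃ s ∈ GSpOver K n, ScalarRel X s)) := by
  have h2 : (2 : AlgebraicClosure K) ≠ 0 := by
    rw [← map_ofNat (algebraMap K (AlgebraicClosure K)) 2]
    exact (map_ne_zero _).2 (Ring.two_ne_zero hchar)
  have hmem_iff (s) : s ∈ Subgroup.closure {A | A ∈ G ∧
      IsTransvection (A : Matrix (Fin n) (Fin n) (AlgebraicClosure K))} ↔ s ∈ SpOver K n := by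
    rw [← hgen, SetLike.mem_coe]
  have hSpG {s} (hs : s ∈ SpOver K n) : s ∈ G :=
    (Subgroup.closure_le G).2 (fun _ hA => hA.1) ((hmem_iff s).2 hs)
  have hkey {g} (hg : g ∈ G) : ∃ c : (AlgebraicClosure K)ˣ, c • g ∈ GSpOver K n := by
    obtain ⟨α, hα⟩ := hGSp g hg
    obtain ⟨c, hc⟩ := exists_forall_mul_apply_mem
      (F := (algebraMap K (AlgebraicClosure K)).fieldRange) hn2 hneven h2 hα
      fun t htF ht => ((hmem_iff _).1
        (conj_mem_closure_transvections hg ((hmem_iff t).2 ⟨htF, ht⟩))).1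
    refine ⟨c, fun i j => by simpa [Units.smul_def] using hc i j, c * c * α, ?_⟩
    simp [Units.smul_def, hα, smul_smul, mul_assoc]
  simp only [scalarRel_iff]
  by_cases hall : ∀ h ∈ GSpOver K n, (∃ c : (AlgebraicClosure K)ˣ, c • h ∈ G) →
      ∃ d : (AlgebraicClosure K)ˣ, d • h ∈ SpOver K n
  · refine Or.inl fun X => ⟨?_, fun ⟨s, hs, hX⟩ => ⟨s, hSpG hs, hX⟩⟩
    rintro ⟨g, hg, lam, rfl⟩
    obtain ⟨c, hc⟩ := hkey hg
    obtain ⟨d, hd⟩ := hall _ hc ⟨c⁻¹, by rwa [inv_smul_smul]⟩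
    exact ⟨_, hd, lam * c⁻¹ * d⁻¹, by simp only [mul_smul, inv_smul_smul]⟩
  · push Not at hall
    obtain ⟨h₀, hh₀, ⟨c, hc⟩, hns⟩ := hall
    obtain ⟨b, hb0, hb⟩ := exists_algebraMap_eq_multiplier hn2 hh₀
    have hbsq : ¬IsSquare b := fun hsq =>
      let ⟨d, hd⟩ := exists_smul_mem_SpOver hh₀.1 hb0 hsq hb
      hns d hd
    refine Or.inr fun X => ⟨?_, ?_⟩
    · rintro ⟨g, hg, lam, rfl⟩
      obtain ⟨c, hc⟩ := hkey hg
      exact ⟨_, hc, lam * c⁻¹, by simp only [mul_smul, inv_smul_smul]⟩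
    · rintro ⟨y, hy, lam, rfl⟩
      obtain ⟨a, ha0, ha⟩ := exists_algebraMap_eq_multiplier hn2 hy
      by_cases hasq : IsSquare a
      · obtain ⟨d, hd⟩ := exists_smul_mem_SpOver hy.1 ha0 hasq ha
        exact ⟨_, hSpG hd, lam * d⁻¹, by simp only [mul_smul, inv_smul_smul]⟩
      · obtain ⟨d, hd⟩ := exists_smul_mem_SpOver (h := y * h₀)
          (mul_apply_mem (F := (algebraMap K (AlgebraicClosure K)).fieldRange.toSubring)
            hy.1 hh₀.1)
          (mul_ne_zero ha0 hb0) (isSquare_mul_of_not_isSquare hasq hbsq) (by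
            calc (y * h₀).valᵀ * stdJ n (AlgebraicClosure K) * (y * h₀).val
                = h₀.valᵀ * (y.valᵀ * stdJ n (AlgebraicClosure K) * y.val) * h₀.val := by
                  simp only [Units.val_mul, transpose_mul, mul_assoc]
              _ = _ := by
                  rw [ha, Matrix.mul_smul, Matrix.smul_mul, hb, smul_smul, map_mul])
        refine ⟨d • (y * h₀) * (c • h₀)⁻¹, G.mul_mem (hSpG hd) (G.inv_mem hc),
          lam * d⁻¹ * c, ?_⟩
        have hinv : (c • h₀)⁻¹ = c⁻¹ • h₀⁻¹ :=
          inv_eq_of_mul_eq_one_right (Units.ext (by simp [Units.smul_def, smul_smul]))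
        rw [hinv]
        exact Units.ext (by simp [Units.smul_def, smul_smul, mul_assoc])
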